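/- arXiv:2105.07491 — 7 statements merged into one kernel-verified Lean document; each statement's English description precedes it below -/
import Mathlib

section
/- Let Q be a 2×2 complex Hermitian positive semidefinite matrix, g the 2×2 real symmetric matrix of entrywise real parts of Q, and Ω = 2·Im(Q₁₂). Then the determinant bound saturates, i.e. det g = Ω²/4, if and only if there exists a nonzero vector ω ∈ ℂ² with Q·ω = 0. -/
open scoped ComplexOrder

/-- The determinant of a 2×2 Hermitian matrix in terms of the real parts of its entries and the
imaginary part of its off-diagonal entry. -/
theorem Matrix.IsHermitian.det_fin_two_eq_ofReal {Q : Matrix (Fin 2) (Fin 2) ℂ}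
    (hQ : Q.IsHermitian) :
    Q.det = (((Q.map Complex.re).det - (Q 0 1).im ^ 2 : ℝ) : ℂ) := by
  have h₀ : (Q 0 0).im = 0 := Complex.conj_eq_iff_im.mp (hQ.apply 0 0)
  have h₁ : (Q 1 1).im = 0 := Complex.conj_eq_iff_im.mp (hQ.apply 1 1)
  have h₁₀ : Q 1 0 = star (Q 0 1) := (hQ.apply 1 0).symm
  apply Complex.ext <;> simp [Matrix.det_fin_two, pow_two, h₀, h₁, h₁₀] <;> ring

/-- For a 2×2 complex Hermitian positive semidefinite matrix `Q`, with
`g` the entrywise real part of `Q` and `Ω = 2·Im(Q₁₂)`, the determinant bound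
saturates, i.e. `det g = Ω²/4`, if and only if `Q` has a nonzero null vector. -/
theorem stmt2 (Q : Matrix (Fin 2) (Fin 2) ℂ) (hQ : Q.PosSemidef)
    (g : Matrix (Fin 2) (Fin 2) ℝ) (hg : ∀ i j, g i j = (Q i j).re)
    (Ω : ℝ) (hΩ : Ω = 2 * (Q 0 1).im) :
    g.det = Ω ^ 2 / 4 ↔ ∃ ω : Fin 2 → ℂ, ω ≠ 0 ∧ Q.mulVec ω = 0 := by
  obtain rfl : g = Q.map Complex.re := Matrix.ext hg
  rw [Matrix.exists_mulVec_eq_zero_iff, hQ.isHermitian.det_fin_two_eq_ofReal,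
    Complex.ofReal_eq_zero, sub_eq_zero, hΩ]
  ring_nf
end

section
/- Let Q be a 2×2 complex Hermitian positive semidefinite matrix, g the 2×2 real symmetric matrix of entrywise real parts of Q, and Ω = 2·Im(Q₁₂). Suppose Ω > 0 and det g = Ω²/4. Then there exists a vector ω ∈ ℂ² such that, for all a, b ∈ {1,2}: i·ε^{ab} = conj(ωᵃ)·ωᵇ − ωᵃ·conj(ωᵇ) and g^{ab}/√(det g) = conj(ωᵃ)·ωᵇ + ωᵃ·conj(ωᵇ), where ε is the antisymmetric symbol ε¹² = −ε²¹ = 1. -/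
open scoped ComplexOrder

/-- A real symmetric unimodular matrix `!![A, B; B, C]` with `0 < A` comes from a complex vector
`(p, (B + i) / (2 p))` with `p` real and positive. -/
theorem exists_real_coords_of_det_one {A B C : ℝ} (hA : 0 < A) (hdet : A * C - B * B = 1) :
    ∃ p x y : ℝ, 2 * (p * p) = A ∧ 2 * (p * x) = B ∧ 2 * (p * y) = 1 ∧
      2 * (x * x + y * y) = C := by
  have hp : 0 < Real.sqrt (A / 2) := Real.sqrt_pos.mpr (by positivity)
  have hpp : Real.sqrt (A / 2) * Real.sqrt (A / 2) = A / 2 := Real.mul_self_sqrt (by positivity)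
  generalize Real.sqrt (A / 2) = p at hp hpp
  obtain rfl : A = 2 * (p * p) := by linarith
  refine ⟨p, B / (2 * p), 1 / (2 * p), rfl, by field_simp, by field_simp, ?_⟩
  field_simp
  linarith

/-- For a 2×2 complex Hermitian positive semidefinite matrix `Q`, with
`g` its entrywise real part and `Ω = 2·Im(Q₁₂)`, if `Ω > 0` and `det g = Ω²/4`,
then there is a complex vector `ω` such that for all `a b`:
`i·ε^{ab} = conj(ωᵃ)·ωᵇ − ωᵃ·conj(ωᵇ)` and
`g^{ab}/√(det g) = conj(ωᵃ)·ωᵇ + ωᵃ·conj(ωᵇ)`,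
where `ε` is the antisymmetric symbol with `ε¹² = −ε²¹ = 1`. -/
theorem stmt3 (Q : Matrix (Fin 2) (Fin 2) ℂ) (hQ : Q.PosSemidef)
    (g : Matrix (Fin 2) (Fin 2) ℝ) (hg : ∀ i j, g i j = (Q i j).re)
    (Ω : ℝ) (hΩ : Ω = 2 * (Q 0 1).im)
    (ε : Matrix (Fin 2) (Fin 2) ℝ) (hε : ε = !![0, 1; -1, 0])
    (hpos : 0 < Ω) (hsat : g.det = Ω ^ 2 / 4) :
    ∃ ω : Fin 2 → ℂ, ∀ a b : Fin 2,
      Complex.I * (ε a b : ℂ) =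
        (starRingEnd ℂ) (ω a) * ω b - ω a * (starRingEnd ℂ) (ω b) ∧
      ((g a b / Real.sqrt g.det : ℝ) : ℂ) =
        (starRingEnd ℂ) (ω a) * ω b + ω a * (starRingEnd ℂ) (ω b) := by
  have hsymm : g 1 0 = g 0 1 := by
    rw [hg, hg, ← hQ.isHermitian.apply 1 0]
    simp
  have hdet : g.det = g 0 0 * g 1 1 - g 0 1 * g 0 1 := by
    rw [Matrix.det_fin_two, hsymm]
  have hdetpos : 0 < g.det := by rw [hsat]; positivity
  have hs : 0 < Real.sqrt g.det := Real.sqrt_pos.mpr hdetpos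
  have hss : Real.sqrt g.det * Real.sqrt g.det = g.det := Real.mul_self_sqrt hdetpos.le
  have h00 : 0 ≤ g 0 0 := by
    rw [hg]
    exact (Complex.le_def.mp (hQ.diag_nonneg (i := 0))).1
  have h00pos : 0 < g 0 0 := by
    refine lt_of_le_of_ne h00 fun h => ?_
    rw [hdet, ← h] at hdetpos
    nlinarith [mul_self_nonneg (g 0 1)]
  generalize Real.sqrt g.det = s at hs hss
  obtain ⟨p, x, y, hpp, hpx, hpy, hxy⟩ :=
    exists_real_coords_of_det_one (A := g 0 0 / s) (B := g 0 1 / s) (C := g 1 1 / s)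
      (by positivity) (by field_simp; linarith)
  refine ⟨![(p : ℂ), ⟨x, y⟩], fun a b => ?_⟩
  subst hε
  fin_cases a <;> fin_cases b <;>
    simp [-Complex.ofReal_div, Complex.ext_iff, hsymm] <;> grind
end

section
/- Let H be a complex Hilbert space and let u : ℝ² → H be a smooth (infinitely differentiable) map with ‖u(k)‖ = 1 for all k ∈ ℝ². Suppose there is a smooth function λ : ℝ² → ℂ such that ∂₁u(k) + i·∂₂u(k) = λ(k)·u(k) for all k, where ∂ᵃ denotes the partial derivative with respect to k_a. Then there exist a smooth nowhere-vanishing function c : ℝ² → ℂ and a holomorphic map v : ℂ → H such that u(k₁,k₂) = c(k₁,k₂)·v(k₁+ik₂) for all (k₁,k₂) ∈ ℝ². -/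
open MeasureTheory Set Metric Filter Topology

/-- The operator `∂₁ + i∂₂` on functions of a complex variable, that is, twice the Wirtinger
derivative `∂/∂z̄`. -/
noncomputable def dbar {E : Type*} [NormedAddCommGroup E] [NormedSpace ℂ E] (f : ℂ → E) (z : ℂ) :
    E :=
  fderiv ℝ f z 1 + Complex.I • fderiv ℝ f z Complex.I

theorem differentiableAt_iff_dbar_eq_zero {E : Type*} [NormedAddCommGroup E] [NormedSpace ℂ E]
    {f : ℂ → E} {z : ℂ} :
    DifferentiableAt ℂ f z ↔ DifferentiableAt ℝ f z ∧ dbar f z = 0 := by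
  rw [differentiableAt_complex_iff_differentiableAt_real, and_congr_right_iff]
  intro _
  rw [dbar, ← smul_right_injective E Complex.I_ne_zero |>.eq_iff (a := _ + _), smul_add, smul_smul,
    Complex.I_mul_I, smul_zero, neg_one_smul, ← sub_eq_add_neg, sub_eq_zero, eq_comm]

theorem locallyIntegrable_complex_inv : LocallyIntegrable (fun z : ℂ ↦ z⁻¹) := by
  intro z
  refine ⟨ball 0 (‖z‖ + 1), isOpen_ball.mem_nhds (by simp), ?_⟩
  have h : IntegrableOn (fun z : ℂ ↦ (fun r : ℝ ↦ r⁻¹) ‖z‖) (ball 0 (‖z‖ + 1)) := by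
    rw [integrableOn_fun_norm_addHaar]
    refine (integrableOn_const (C := (1 : ℝ)) (by simp)).congr_fun ?_ measurableSet_Ioo
    intro y hy
    simp [hy.1.ne']
  refine Integrable.mono' h (by fun_prop) (ae_of_all _ fun w ↦ by simp)

/-- The fundamental solution property of `1/z` for `∂/∂z̄`. -/
theorem integral_inv_mul_dbar {h : ℂ → ℂ} (hh : ContDiff ℝ 1 h) (hc : HasCompactSupport h) :
    ∫ w : ℂ, w⁻¹ * dbar h w = -(2 * Real.pi) * h 0 := by
  obtain ⟨R, hR0, hR⟩ : ∃ R : ℝ, 0 < R ∧ ∀ w : ℂ, R < ‖w‖ → w ∉ tsupport h := by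
    obtain ⟨R, hR0, hR⟩ := hc.isCompact.isBounded.exists_pos_norm_le
    exact ⟨R, hR0, fun w hw hm ↦ (hR w hm).not_gt hw⟩
  set e : ℝ → ℂ := fun θ ↦ Real.cos θ + Real.sin θ * Complex.I with he
  have hecont : Continuous e := by fun_prop
  have hnorm : ∀ θ, ‖e θ‖ = 1 := fun θ ↦ by simp [he, Complex.norm_cos_add_sin_mul_I]
  have hsq : ∀ θ, e θ * (Real.cos θ - Real.sin θ * Complex.I) = 1 := fun θ ↦ by
    have := Complex.cos_sq_add_sin_sq θ
    simp only [he, Complex.ofReal_cos, Complex.ofReal_sin]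
    linear_combination this - Complex.sin θ ^ 2 * Complex.I_sq
  have hderiv : ∀ θ, HasDerivAt e (Complex.I * e θ) θ := fun θ ↦ by
    have h1 := (Real.hasDerivAt_cos θ).ofReal_comp
    have h2 := (Real.hasDerivAt_sin θ).ofReal_comp.mul_const Complex.I
    refine (h1.add h2).congr_deriv ?_
    simp only [he]
    push_cast
    linear_combination - Complex.sin θ * Complex.I_sq
  have hfd : Continuous (fderiv ℝ h) := hh.continuous_fderiv one_ne_zero
  -- the radial derivative and the normalized angular derivative
  set A : ℝ × ℝ → ℂ := fun p ↦ fderiv ℝ h (p.1 * e p.2) (e p.2) with hA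
  set B : ℝ × ℝ → ℂ := fun p ↦ fderiv ℝ h (p.1 * e p.2) (Complex.I * e p.2) with hB
  have hAc : Continuous A := by fun_prop
  have hBc : Continuous B := by fun_prop
  have hint : ∀ F : ℝ × ℝ → ℂ, Continuous F →
      (∀ p : ℝ × ℝ, fderiv ℝ h (p.1 * e p.2) = 0 → F p = 0) →
      IntegrableOn F (Ioi 0 ×ˢ Ioo (-Real.pi) Real.pi) := by
    intro F hF h0
    have hK : IntegrableOn F (Icc 0 R ×ˢ Icc (-Real.pi) Real.pi) :=
      hF.continuousOn.integrableOn_compact (isCompact_Icc.prod isCompact_Icc)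
    refine hK.of_forall_sdiff_eq_zero (measurableSet_Ioi.prod measurableSet_Ioo) ?_
    rintro ⟨r, θ⟩ ⟨⟨hr, hθ⟩, hn⟩
    have hr' : (0 : ℝ) < r := hr
    refine h0 _ (image_eq_zero_of_notMem_tsupport fun hm ↦ ?_)
    refine hR _ ?_ (tsupport_fderiv_subset ℝ hm)
    have : R < r := by
      by_contra! hcon
      exact hn ⟨⟨hr'.le, hcon⟩, hθ.1.le, hθ.2.le⟩
    simpa [hnorm, abs_of_pos hr'] using this
  have hAi := hint A hAc fun p hp ↦ by simp [hA, hp]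
  have hBi := hint B hBc fun p hp ↦ by simp [hB, hp]
  have hIA : ∫ p in Ioi 0 ×ˢ Ioo (-Real.pi) Real.pi, A p = -(2 * Real.pi) * h 0 := by
    rw [Measure.volume_eq_prod, ← Measure.prod_restrict, integral_prod_symm]
    · have : ∀ θ : ℝ, ∫ r in Ioi (0 : ℝ), A (r, θ) = - h 0 := by
        intro θ
        have hl : ContDiff ℝ 1 fun r : ℝ ↦ h (r * e θ) :=
          hh.comp (Complex.ofRealCLM.contDiff.mul contDiff_const)
        have hs : HasCompactSupport fun r : ℝ ↦ h (r * e θ) := by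
          refine HasCompactSupport.intro (isCompact_Icc (a := -R) (b := R)) fun r hr ↦ ?_
          refine image_eq_zero_of_notMem_tsupport (hR _ ?_)
          have : R < |r| := by
            by_contra! hcon
            exact hr (abs_le.mp hcon)
          simpa [hnorm] using this
        have hd : ∀ r : ℝ, deriv (fun r : ℝ ↦ h (r * e θ)) r = A (r, θ) := fun r ↦ by
          have h1 := (hasDerivAt_id r).ofReal_comp.mul_const (e θ)
          have h2 := (hh.differentiable one_ne_zero _).hasFDerivAt.comp_hasDerivAt r h1
          simpa using! h2.deriv
        have := hs.integral_Ioi_deriv_eq hl 0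
        simpa [hd] using this
      simp only [this]
      have hp := Real.pi_pos
      simp [hp.le, ← two_mul]
    · rw [Measure.prod_restrict]; exact hAi
  have hIB : ∫ p in Ioi 0 ×ˢ Ioo (-Real.pi) Real.pi, B p = 0 := by
    rw [Measure.volume_eq_prod, setIntegral_prod _ hBi]
    refine setIntegral_eq_zero_of_forall_eq_zero fun r hr ↦ ?_
    have hr0 : (r : ℂ) ≠ 0 := Complex.ofReal_ne_zero.mpr (ne_of_gt hr)
    have hd : ∀ θ : ℝ, HasDerivAt (fun θ : ℝ ↦ h (r * e θ)) (r * B (r, θ)) θ := fun θ ↦ by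
      have h1 := (hderiv θ).const_mul (r : ℂ)
      have h2 := (hh.differentiable one_ne_zero _).hasFDerivAt.comp_hasDerivAt θ h1
      refine h2.congr_deriv ?_
      simpa using (fderiv ℝ h (r * e θ)).map_smul r (Complex.I * e θ)
    have hBr : Continuous fun θ ↦ B (r, θ) := by fun_prop
    have := intervalIntegral.integral_eq_sub_of_hasDerivAt (a := -Real.pi) (b := Real.pi)
      (fun θ _ ↦ hd θ) ((continuous_const.mul hBr).intervalIntegrable _ _)
    rw [intervalIntegral.integral_const_mul, intervalIntegral.integral_of_le
      (by linarith [Real.pi_pos]), integral_Ioc_eq_integral_Ioo] at this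
    simpa [he, hr0] using this
  rw [← Complex.integral_comp_polarCoord_symm]
  change ∫ p in Ioi 0 ×ˢ Ioo (-Real.pi) Real.pi, _ = _
  have hcongr : ∀ p ∈ Ioi (0 : ℝ) ×ˢ Ioo (-Real.pi) Real.pi,
      p.1 • ((Complex.polarCoord.symm p)⁻¹ * dbar h (Complex.polarCoord.symm p)) =
        A p + Complex.I * B p := by
    rintro ⟨r, θ⟩ ⟨hr, -⟩
    have hr0 : (r : ℂ) ≠ 0 := Complex.ofReal_ne_zero.mpr (ne_of_gt hr)
    have hinv : (e θ)⁻¹ = Real.cos θ - Real.sin θ * Complex.I :=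
      inv_eq_of_mul_eq_one_right (hsq θ)
    have hlin : ∀ (T : ℂ →L[ℝ] ℂ) (x y : ℝ), T (x + y * Complex.I) = x * T 1 + y * T Complex.I := by
      intro T x y
      have : (x + y * Complex.I : ℂ) = x • (1 : ℂ) + y • Complex.I := by simp
      rw [this, map_add, map_smul, map_smul, Complex.real_smul, Complex.real_smul]
    have hIe : Complex.I * e θ = ((-Real.sin θ : ℝ) : ℂ) + (Real.cos θ : ℝ) * Complex.I := by
      simp only [he]; push_cast
      linear_combination Complex.sin θ * Complex.I_sq
    have hT : ∀ T : ℂ →L[ℝ] ℂ, (Real.cos θ - Real.sin θ * Complex.I) *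
        (T 1 + Complex.I * T Complex.I) = T (e θ) + Complex.I * T (Complex.I * e θ) := by
      intro T
      rw [hIe]
      simp only [he, hlin]
      push_cast
      linear_combination (-Complex.sin θ * T Complex.I) * Complex.I_sq
    rw [Complex.polarCoord_symm_apply]
    change r • ((r * e θ)⁻¹ * dbar h (r * e θ)) = A (r, θ) + Complex.I * B (r, θ)
    simp only [hA, hB]
    rw [← hT, mul_inv, hinv, dbar, Complex.real_smul, smul_eq_mul, ← mul_assoc, ← mul_assoc,
      mul_inv_cancel₀ hr0, one_mul]
  rw [setIntegral_congr_fun (measurableSet_Ioi.prod measurableSet_Ioo) hcongr,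
    integral_add hAi (hBi.const_mul _), integral_const_mul, hIA, hIB]
  simp

theorem dbar_add {E : Type*} [NormedAddCommGroup E] [NormedSpace ℂ E] {f g : ℂ → E} {z : ℂ}
    (hf : DifferentiableAt ℝ f z) (hg : DifferentiableAt ℝ g z) :
    dbar (f + g) z = dbar f z + dbar g z := by
  simp only [dbar, fderiv_add hf hg, add_apply, smul_add]
  abel

theorem dbar_sub {E : Type*} [NormedAddCommGroup E] [NormedSpace ℂ E] {f g : ℂ → E} {z : ℂ}
    (hf : DifferentiableAt ℝ f z) (hg : DifferentiableAt ℝ g z) :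
    dbar (f - g) z = dbar f z - dbar g z := by
  simp only [dbar, fderiv_sub hf hg, sub_apply, smul_sub]
  abel

theorem exists_contDiff_dbar_eq_of_hasCompactSupport {g : ℂ → ℂ} (hg : ContDiff ℝ (⊤ : ℕ∞) g)
    (hc : HasCompactSupport g) : ∃ f : ℂ → ℂ, ContDiff ℝ (⊤ : ℕ∞) f ∧ ∀ z, dbar f z = g z := by
  have hg1 : ContDiff ℝ 1 g := hg.of_le (by exact_mod_cast le_top)
  have hk : LocallyIntegrable (fun w : ℂ ↦ (2 * Real.pi : ℂ)⁻¹ * w⁻¹) := 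
    locallyIntegrable_complex_inv.smul (2 * Real.pi : ℂ)⁻¹
  refine ⟨convolution (fun w : ℂ ↦ (2 * Real.pi : ℂ)⁻¹ * w⁻¹) g (.mul ℝ ℂ) volume,
    hc.contDiff_convolution_right _ hk hg, fun z ↦ ?_⟩
  have hfd := (hc.hasFDerivAt_convolution_right (.mul ℝ ℂ) hk hg1 z).fderiv
  have hcont := hg1.continuous_fderiv one_ne_zero
  have hcv : ∀ v : ℂ, HasCompactSupport fun a ↦ fderiv ℝ g a v := fun v ↦ hc.fderiv_apply ℝ v
  have hex : ∀ v : ℂ, Integrable fun t : ℂ ↦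
      (2 * Real.pi : ℂ)⁻¹ * t⁻¹ * fderiv ℝ g (z - t) v := fun v ↦
    (hcv v).convolutionExists_right (.mul ℝ ℂ) hk (by fun_prop) z
  have hh : ContDiff ℝ 1 fun t ↦ g (z - t) := hg1.comp (contDiff_const.sub contDiff_id)
  have hhc : HasCompactSupport fun t ↦ g (z - t) :=
    hc.comp_homeomorph (Homeomorph.subLeft z)
  have hdb : ∀ t, dbar (fun t ↦ g (z - t)) t = - dbar g (z - t) := fun t ↦ by
    have h1 : HasFDerivAt (fun t ↦ g (z - t)) ((fderiv ℝ g (z - t)).comp (-.id ℝ ℂ)) t :=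
      (hg1.differentiable one_ne_zero (z - t)).hasFDerivAt.comp t ((hasFDerivAt_id t).const_sub z)
    rw [dbar, h1.fderiv]
    simp [dbar]
    ring
  have hkey := integral_inv_mul_dbar hh hhc
  rw [dbar, hfd, convolution_precompR_apply _ hk (hc.fderiv ℝ) hcont,
    convolution_precompR_apply _ hk (hc.fderiv ℝ) hcont]
  simp only [convolution_def, ContinuousLinearMap.mul_apply', smul_eq_mul]
  rw [← integral_const_mul, ← integral_add (hex 1) ((hex _).const_mul _)]
  have hpi : (2 * Real.pi : ℂ) ≠ 0 := by simp [Real.pi_ne_zero]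
  calc _ = ∫ t : ℂ, -(2 * Real.pi : ℂ)⁻¹ * (t⁻¹ * dbar (fun t ↦ g (z - t)) t) := by
        refine integral_congr_ae (ae_of_all _ fun t ↦ ?_)
        simp only [hdb]
        simp only [dbar, smul_eq_mul]
        ring
    _ = g z := by
        rw [integral_const_mul, hkey, sub_zero]
        field_simp

/-- Approximation by Taylor polynomials on a smaller ball. -/
theorem DifferentiableOn.exists_entire_norm_sub_le {f : ℂ → ℂ} {r R : ℝ} (hr : 0 < r) (hrR : r < R)
    (hf : DifferentiableOn ℂ f (ball 0 R)) {ε : ℝ} (hε : 0 < ε) :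
    ∃ p : ℂ → ℂ, Differentiable ℂ p ∧ ∀ z ∈ ball (0 : ℂ) r, ‖f z - p z‖ ≤ ε := by
  obtain ⟨s, hrs, hsR⟩ := exists_between hrR
  lift r to NNReal using hr.le
  lift s to NNReal using (hr.trans hrs).le
  have hs : 0 < s := by exact_mod_cast hr.trans hrs
  have h := (hf.mono (closedBall_subset_ball hsR)).hasFPowerSeriesOnBall hs
  have hu := Metric.tendstoUniformlyOn_iff.mp
    (h.tendstoUniformlyOn (r' := r) (by exact_mod_cast hrs)) ε hε
  obtain ⟨n, hn⟩ := hu.exists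
  refine ⟨(cauchyPowerSeries f 0 s).partialSum n, ?_, fun z hz ↦ ?_⟩
  · unfold FormalMultilinearSeries.partialSum
    simp only [FormalMultilinearSeries.apply_eq_pow_smul_coeff]
    fun_prop
  · simpa [dist_eq_norm] using (hn z hz).le

/-- Solvability of the inhomogeneous Cauchy–Riemann equation on the plane. -/
theorem exists_contDiff_dbar_eq {g : ℂ → ℂ} (hg : ContDiff ℝ (⊤ : ℕ∞) g) :
    ∃ f : ℂ → ℂ, ContDiff ℝ (⊤ : ℕ∞) f ∧ ∀ z, dbar f z = g z := by
  -- solutions on balls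
  have hloc : ∀ n : ℕ, ∃ f : ℂ → ℂ, ContDiff ℝ (⊤ : ℕ∞) f ∧
      ∀ z ∈ ball (0 : ℂ) (n + 2), dbar f z = g z := by
    intro n
    let χ : ContDiffBump (0 : ℂ) := ⟨n + 2, n + 3, by positivity, by linarith⟩
    obtain ⟨f, hf, hfg⟩ := exists_contDiff_dbar_eq_of_hasCompactSupport
      (g := fun z ↦ χ z • g z) (χ.contDiff.smul hg) χ.hasCompactSupport.smul_right
    refine ⟨f, hf, fun z hz ↦ ?_⟩
    rw [hfg, χ.one_of_mem_closedBall (ball_subset_closedBall hz), one_smul]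
  choose f hf hfg using hloc
  have hfd : ∀ n z, DifferentiableAt ℝ (f n) z := fun n z ↦
    (hf n).differentiable (by simp) z
  have happrox : ∀ n : ℕ, ∃ p : ℂ → ℂ, Differentiable ℂ p ∧
      ∀ z ∈ ball (0 : ℂ) (n + 1), ‖(f (n + 1) - f n) z - p z‖ ≤ (1 / 2) ^ n := by
    intro n
    refine DifferentiableOn.exists_entire_norm_sub_le (R := n + 2) (by positivity) (by linarith)
      (fun z hz ↦ ?_) (by positivity)
    refine (differentiableAt_iff_dbar_eq_zero.mpr
      ⟨(hfd _ z).sub (hfd _ z), ?_⟩).differentiableWithinAt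
    rw [dbar_sub (hfd _ z) (hfd _ z), hfg n z hz, hfg (n + 1) z, sub_self]
    refine ball_subset_ball ?_ hz
    push_cast
    linarith
  choose p hp hpf using happrox
  -- corrected solutions, with summable increments
  set F : ℕ → ℂ → ℂ := fun n z ↦ f n z - ∑ j ∈ Finset.range n, p j z with hF
  have hFsmooth : ∀ n, ContDiff ℝ (⊤ : ℕ∞) (F n) := fun n ↦
    (hf n).sub (ContDiff.sum fun j _ ↦ (hp j).contDiff.restrict_scalars ℝ)
  have hFd : ∀ n z, DifferentiableAt ℝ (F n) z := fun n z ↦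
    (hFsmooth n).differentiable (by simp) z
  have hFg : ∀ n : ℕ, ∀ z ∈ ball (0 : ℂ) (n + 2), dbar (F n) z = g z := by
    intro n z hz
    have hs : DifferentiableAt ℂ (fun z ↦ ∑ j ∈ Finset.range n, p j z) z :=
      DifferentiableAt.fun_sum fun j _ ↦ hp j z
    obtain ⟨h1, h2⟩ := differentiableAt_iff_dbar_eq_zero.mp hs
    have := dbar_sub (hfd n z) h1
    rw [h2, sub_zero, hfg n z hz] at this
    exact this
  set D : ℕ → ℂ → ℂ := fun n z ↦ F (n + 1) z - F n z with hD
  have hDle : ∀ n : ℕ, ∀ z ∈ ball (0 : ℂ) (n + 1), ‖D n z‖ ≤ (1 / 2) ^ n := by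
    intro n z hz
    convert hpf n z hz using 2
    simp only [hD, hF, Finset.sum_range_succ, Pi.sub_apply]
    ring
  have hDd : ∀ n : ℕ, DifferentiableOn ℂ (D n) (ball 0 (n + 1)) := by
    intro n z hz
    refine (differentiableAt_iff_dbar_eq_zero.mpr
      ⟨(hFd _ z).sub (hFd _ z), ?_⟩).differentiableWithinAt
    have := dbar_sub (hFd (n + 1) z) (hFd n z)
    rw [hFg n z (ball_subset_ball (by linarith) hz),
      hFg (n + 1) z (ball_subset_ball (by push_cast; linarith) hz), sub_self] at this
    exact this
  have hball : ∀ m j : ℕ, ball (0 : ℂ) (m + 1) ⊆ ball 0 ((j + m : ℕ) + 1) := fun m j ↦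
    ball_subset_ball (by push_cast; linarith [j.cast_nonneg (α := ℝ)])
  have hgeo : ∀ m : ℕ, Summable fun j : ℕ ↦ (1 / 2 : ℝ) ^ (j + m) := fun m ↦
    (summable_nat_add_iff m).mpr summable_geometric_two
  set G : ℂ → ℂ := fun z ↦ F 0 z + ∑' j, D j z with hG
  have hGF : ∀ m : ℕ, EqOn G (F m + fun z ↦ ∑' j, D (j + m) z) (ball 0 (m + 1)) := by
    intro m z hz
    have hsum : Summable fun j ↦ D (j + m) z :=
      Summable.of_norm_bounded (hgeo m) fun j ↦ hDle (j + m) z (hball m j hz)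
    have h1 := Summable.sum_add_tsum_nat_add' (f := fun j ↦ D j z) hsum
    have h2 : ∑ j ∈ Finset.range m, D j z = F m z - F 0 z :=
      Finset.sum_range_sub (fun j ↦ F j z) m
    simp only [hG, Pi.add_apply]
    rw [← h1, h2]
    ring
  have hT : ∀ m : ℕ, DifferentiableOn ℂ (fun z ↦ ∑' j, D (j + m) z) (ball 0 (m + 1)) := fun m ↦
    Complex.differentiableOn_tsum_of_summable_norm (hgeo m)
      (fun j ↦ (hDd (j + m)).mono (hball m j)) isOpen_ball fun j z hz ↦ hDle (j + m) z (hball m j hz)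
  have hmem : ∀ z : ℂ, ∃ m : ℕ, ball (0 : ℂ) (m + 1) ∈ 𝓝 z := fun z ↦ by
    obtain ⟨m, hm⟩ := exists_nat_gt ‖z‖
    exact ⟨m, isOpen_ball.mem_nhds (by simpa using hm.trans (lt_add_one _))⟩
  refine ⟨G, contDiff_iff_contDiffAt.mpr fun z ↦ ?_, fun z ↦ ?_⟩
  · obtain ⟨m, hm⟩ := hmem z
    refine ContDiffAt.congr_of_eventuallyEq ?_ ((hGF m).eventuallyEq_of_mem hm)
    exact (hFsmooth m).contDiffAt.add
      (((hT m).contDiffOn isOpen_ball).contDiffAt hm |>.restrict_scalars ℝ)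
  · obtain ⟨m, hm⟩ := hmem z
    obtain ⟨h1, h2⟩ := differentiableAt_iff_dbar_eq_zero.mp ((hT m).differentiableAt hm)
    rw [dbar, ((hGF m).eventuallyEq_of_mem hm).fderiv_eq]
    change dbar _ z = _
    rw [dbar_add (hFd m z) h1, h2, add_zero]
    exact hFg m z (ball_subset_ball (by linarith) (mem_of_mem_nhds hm))

/-- If `u` satisfies `∂̄u = λu` and `∂̄f = λ`, then `exp(-f) u` is holomorphic. -/
theorem differentiable_exp_neg_smul_of_dbar_eq {E : Type*} [NormedAddCommGroup E] [NormedSpace ℂ E]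
    {u : ℂ → E} {f l : ℂ → ℂ} (hu : Differentiable ℝ u) (hf : Differentiable ℝ f)
    (hul : ∀ z, dbar u z = l z • u z) (hfl : ∀ z, dbar f z = l z) :
    Differentiable ℂ fun z ↦ Complex.exp (-f z) • u z := by
  intro z
  have he : HasFDerivAt (fun z ↦ Complex.exp (-f z)) _ z := (hf z).hasFDerivAt.neg.cexp
  have h : HasFDerivAt (fun z ↦ Complex.exp (-f z) • u z) _ z := he.smul (hu z).hasFDerivAt
  refine differentiableAt_iff_dbar_eq_zero.mpr ⟨h.differentiableAt, ?_⟩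
  have hul := hul z
  have hfl := hfl z
  simp only [dbar, smul_eq_mul] at hul hfl
  rw [dbar, h.fderiv]
  have hI : fderiv ℝ u z 1 = l z • u z - Complex.I • fderiv ℝ u z Complex.I := eq_sub_of_add_eq hul
  simp [hI, ← hfl]
  module


/-- If `u : ℝ² → H` is a smooth normalized family of states whose
anti-holomorphic derivative `∂₁u + i∂₂u` is everywhere parallel to `u` (with a smooth
proportionality factor `λ`), then there are a smooth nowhere-vanishing scalar `c` and a
holomorphic `v : ℂ → H` with `u(k₁,k₂) = c(k₁,k₂)·v(k₁+ik₂)`. -/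
theorem stmt6 {H : Type*} [NormedAddCommGroup H] [InnerProductSpace ℂ H]
    (u : ℝ × ℝ → H) (hu : ContDiff ℝ (⊤ : ℕ∞) u) (hnorm : ∀ k, ‖u k‖ = 1)
    (lam : ℝ × ℝ → ℂ) (hlam : ContDiff ℝ (⊤ : ℕ∞) lam)
    (hanti : ∀ k : ℝ × ℝ,
      fderiv ℝ u k (1, 0) + Complex.I • fderiv ℝ u k (0, 1) = lam k • u k) :
    ∃ (c : ℝ × ℝ → ℂ) (v : ℂ → H), ContDiff ℝ (⊤ : ℕ∞) c ∧ (∀ k, c k ≠ 0) ∧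
      Differentiable ℂ v ∧
      ∀ k : ℝ × ℝ, u k = c k • v ((k.1 : ℂ) + (k.2 : ℂ) * Complex.I) := by
  let e : ℂ ≃L[ℝ] ℝ × ℝ := Complex.equivRealProdCLM
  have he : ContDiff ℝ (⊤ : ℕ∞) e := e.contDiff
  obtain ⟨f, hf, hfl⟩ := exists_contDiff_dbar_eq (hlam.comp he)
  have hul : ∀ z, dbar (u ∘ e) z = lam (e z) • (u ∘ e) z := fun z ↦ by
    rw [dbar, e.comp_right_fderiv]
    simpa [e] using hanti (e z)
  have hv := differentiable_exp_neg_smul_of_dbar_eq ((hu.comp he).differentiable (by simp))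
    (hf.differentiable (by simp)) hul hfl
  refine ⟨fun k ↦ Complex.exp (f (e.symm k)), _, (hf.comp e.symm.contDiff).cexp,
    fun k ↦ Complex.exp_ne_zero _, hv, fun k ↦ ?_⟩
  have hk : (k.1 : ℂ) + k.2 * Complex.I = e.symm k := by
    simp [e, Complex.equivRealProdCLM_symm_apply]
  rw [hk, smul_smul, ← Complex.exp_add, add_neg_cancel, Complex.exp_zero, one_smul,
    Function.comp_apply, e.apply_symm_apply]
end

section
/- Let f : ℂ → ℂ be entire, b₁, b₂ ∈ ℂ, and let φ₁, φ₂ : ℂ → ℂ be entire functions such that f(k + b₁) = exp(i·φ₁(k))·f(k) and f(k + b₂) = exp(i·φ₂(k))·f(k) for all k ∈ ℂ. Let k₀ ∈ ℂ and suppose f has no zeros on the four boundary segments of the parallelogram with vertices k₀, k₀+b₁, k₀+b₁+b₂, k₀+b₂. Then the contour integral of f'(k)/f(k) along this parallelogram boundary, traversed k₀ → k₀+b₁ → k₀+b₁+b₂ → k₀+b₂ → k₀, equals i·[φ₁(k₀+b₂) − φ₁(k₀) − φ₂(k₀+b₁) + φ₂(k₀)]. -/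
open Complex in
/-- If `f (k + b) = exp (I * φ k) * f k`, the logarithmic derivative of `f` shifts by `I * φ'`. -/
theorem deriv_div_shift_of_quasiperiodic {f φ : ℂ → ℂ} (hf : Differentiable ℂ f)
    (hφ : Differentiable ℂ φ) {b : ℂ} (h : ∀ k, f (k + b) = exp (I * φ k) * f k)
    {k : ℂ} (hk : f k ≠ 0) :
    deriv f (k + b) / f (k + b) = I * deriv φ k + deriv f k / f k := by
  have h1 : HasDerivAt (fun z => f (z + b)) (deriv f (k + b)) k :=
    (hf (k + b)).hasDerivAt.comp_add_const k b
  have h2 : HasDerivAt (fun z => exp (I * φ z) * f z)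
      (exp (I * φ k) * (I * deriv φ k) * f k + exp (I * φ k) * deriv f k) k :=
    (((hφ k).hasDerivAt.const_mul I).cexp).mul (hf k).hasDerivAt
  rw [h1.unique (by simpa only [h] using h2), h]
  have := exp_ne_zero (I * φ k)
  field_simp

/-- The difference of the integrals of `f' / f` along two opposite sides of a parallelogram, for
`f` quasi-periodic under the translation from one side to the other. -/
theorem integral_deriv_div_shift_sub {f φ : ℂ → ℂ} (hf : Differentiable ℂ f)
    (hφ : Differentiable ℂ φ) {b : ℂ}
    (h : ∀ k, f (k + b) = Complex.exp (Complex.I * φ k) * f k) (k c : ℂ)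
    (hz : ∀ t ∈ Set.Icc (0 : ℝ) 1, f (k + (t : ℂ) * c) ≠ 0) :
    (∫ t in (0 : ℝ)..1, c * deriv f (k + b + (t : ℂ) * c) / f (k + b + (t : ℂ) * c)) -
      (∫ t in (0 : ℝ)..1, c * deriv f (k + (t : ℂ) * c) / f (k + (t : ℂ) * c)) =
    Complex.I * (φ (k + c) - φ k) := by
  have hf' : Continuous (deriv f) := hf.contDiff.continuous_deriv le_top
  have hφ' : Continuous (deriv φ) := hφ.contDiff.continuous_deriv le_top
  have hIcc : Set.uIcc (0 : ℝ) 1 = Set.Icc 0 1 := Set.uIcc_of_le zero_le_one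
  have hint : IntervalIntegrable
      (fun t : ℝ => c * deriv f (k + (t : ℂ) * c) / f (k + (t : ℂ) * c))
      MeasureTheory.volume 0 1 := by
    apply ContinuousOn.intervalIntegrable
    rw [hIcc]
    exact ContinuousOn.div (by fun_prop) (hf.continuous.comp (by fun_prop)).continuousOn hz
  have hintφ : IntervalIntegrable (fun t : ℝ => Complex.I * (deriv φ (k + (t : ℂ) * c) * c))
      MeasureTheory.volume 0 1 :=
    Continuous.intervalIntegrable (by fun_prop) _ _
  have hshift : (∫ t in (0 : ℝ)..1,
        c * deriv f (k + b + (t : ℂ) * c) / f (k + b + (t : ℂ) * c)) =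
      ∫ t in (0 : ℝ)..1, (Complex.I * (deriv φ (k + (t : ℂ) * c) * c) +
        c * deriv f (k + (t : ℂ) * c) / f (k + (t : ℂ) * c)) := by
    refine intervalIntegral.integral_congr fun t ht => ?_
    rw [hIcc] at ht
    simp only [add_right_comm k b, mul_div_assoc,
      deriv_div_shift_of_quasiperiodic hf hφ h (hz t ht)]
    ring
  have hftc : (∫ t in (0 : ℝ)..1, Complex.I * (deriv φ (k + (t : ℂ) * c) * c)) =
      Complex.I * φ (k + ((1 : ℝ) : ℂ) * c) - Complex.I * φ (k + ((0 : ℝ) : ℂ) * c) := by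
    refine intervalIntegral.integral_eq_sub_of_hasDerivAt
      (f := fun t : ℝ => Complex.I * φ (k + (t : ℂ) * c)) (fun t _ => ?_) hintφ
    have hline : HasDerivAt (fun z : ℂ => k + z * c) c (t : ℂ) := by
      simpa using ((hasDerivAt_id (t : ℂ)).mul_const c).const_add k
    exact (((hφ _).hasDerivAt.comp (t : ℂ) hline).const_mul Complex.I).comp_ofReal
  rw [hshift, intervalIntegral.integral_add hintφ hint, hftc]
  simp
  ring

/-- Reversing the orientation of a segment negates the integral of `g / f` along it. -/
theorem integral_reverse_segment (f g : ℂ → ℂ) (k c : ℂ) :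
    (∫ t in (0 : ℝ)..1, (-c) * g (k + c - (t : ℂ) * c) / f (k + c - (t : ℂ) * c)) =
      -∫ t in (0 : ℝ)..1, c * g (k + (t : ℂ) * c) / f (k + (t : ℂ) * c) := by
  have hrev := intervalIntegral.integral_comp_sub_left (a := 0) (b := 1)
    (fun t : ℝ => c * g (k + (t : ℂ) * c) / f (k + (t : ℂ) * c)) 1
  rw [sub_self, sub_zero] at hrev
  rw [← hrev, ← intervalIntegral.integral_neg]
  refine intervalIntegral.integral_congr fun t _ => ?_
  have hpt : k + ((1 - t : ℝ) : ℂ) * c = k + c - (t : ℂ) * c := by push_cast; ring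
  simp only [hpt, neg_mul, neg_div]

/-- For an entire `f` with holomorphic quasi-periodicity phases
`f(k+b₁) = e^{iφ₁(k)}f(k)` and `f(k+b₂) = e^{iφ₂(k)}f(k)`, if `f` has no zeros on the
boundary of the parallelogram with vertices `k₀, k₀+b₁, k₀+b₁+b₂, k₀+b₂`, then the
contour integral of `f'/f` along that boundary equals
`i·[φ₁(k₀+b₂) − φ₁(k₀) − φ₂(k₀+b₁) + φ₂(k₀)]`. -/
theorem stmt10 (f : ℂ → ℂ) (hf : Differentiable ℂ f) (b₁ b₂ : ℂ)
    (φ₁ φ₂ : ℂ → ℂ) (hφ₁ : Differentiable ℂ φ₁) (hφ₂ : Differentiable ℂ φ₂)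
    (hA : ∀ k, f (k + b₁) = Complex.exp (Complex.I * φ₁ k) * f k)
    (hB : ∀ k, f (k + b₂) = Complex.exp (Complex.I * φ₂ k) * f k)
    (k₀ : ℂ)
    (hz : ∀ t ∈ Set.Icc (0 : ℝ) 1,
      f (k₀ + (t : ℂ) * b₁) ≠ 0 ∧ f (k₀ + b₁ + (t : ℂ) * b₂) ≠ 0 ∧
      f (k₀ + b₂ + (t : ℂ) * b₁) ≠ 0 ∧ f (k₀ + (t : ℂ) * b₂) ≠ 0) :
    (∫ t in (0 : ℝ)..1, b₁ * deriv f (k₀ + (t : ℂ) * b₁) / f (k₀ + (t : ℂ) * b₁)) +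
    (∫ t in (0 : ℝ)..1, b₂ * deriv f (k₀ + b₁ + (t : ℂ) * b₂) / f (k₀ + b₁ + (t : ℂ) * b₂)) +
    (∫ t in (0 : ℝ)..1,
      (-b₁) * deriv f (k₀ + b₁ + b₂ - (t : ℂ) * b₁) / f (k₀ + b₁ + b₂ - (t : ℂ) * b₁)) +
    (∫ t in (0 : ℝ)..1,
      (-b₂) * deriv f (k₀ + b₂ - (t : ℂ) * b₂) / f (k₀ + b₂ - (t : ℂ) * b₂))
    = Complex.I * (φ₁ (k₀ + b₂) - φ₁ k₀ - φ₂ (k₀ + b₁) + φ₂ k₀) := by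
  have h₁ := integral_deriv_div_shift_sub hf hφ₁ hA k₀ b₂ fun t ht => (hz t ht).2.2.2
  have h₂ := integral_deriv_div_shift_sub hf hφ₂ hB k₀ b₁ fun t ht => (hz t ht).1
  have h₃ := integral_reverse_segment f (deriv f) (k₀ + b₂) b₁
  have h₄ := integral_reverse_segment f (deriv f) k₀ b₂
  rw [add_right_comm k₀ b₁ b₂, h₃, h₄]
  linear_combination h₁ - h₂
end

section
/- Let f : ℂ → ℂ be any function, b₁, b₂ ∈ ℂ, and φ₁, φ₂ : ℂ → ℂ functions satisfying f(k + b₁) = exp(i·φ₁(k))·f(k) and f(k + b₂) = exp(i·φ₂(k))·f(k) for all k ∈ ℂ. Let k₀ ∈ ℂ with f(k₀) ≠ 0. Then φ₂(k₀+b₁) − φ₂(k₀) + φ₁(k₀) − φ₁(k₀+b₂) ∈ 2π·ℤ, i.e., there exists an integer n with φ₂(k₀+b₁) − φ₂(k₀) + φ₁(k₀) − φ₁(k₀+b₂) = 2πn. -/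
/-- For a function `f` with quasi-periodicity phases
`f(k+b₁) = e^{iφ₁(k)}f(k)` and `f(k+b₂) = e^{iφ₂(k)}f(k)`, and a point `k₀` where
`f(k₀) ≠ 0`, the combination `φ₂(k₀+b₁) − φ₂(k₀) + φ₁(k₀) − φ₁(k₀+b₂)` lies in `2π·ℤ`. -/
theorem stmt11 (f : ℂ → ℂ) (b₁ b₂ : ℂ) (φ₁ φ₂ : ℂ → ℂ)
    (hA : ∀ k, f (k + b₁) = Complex.exp (Complex.I * φ₁ k) * f k)
    (hB : ∀ k, f (k + b₂) = Complex.exp (Complex.I * φ₂ k) * f k)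
    (k₀ : ℂ) (h0 : f k₀ ≠ 0) :
    ∃ n : ℤ, φ₂ (k₀ + b₁) - φ₂ k₀ + φ₁ k₀ - φ₁ (k₀ + b₂)
      = 2 * (Real.pi : ℂ) * (n : ℂ) := by
  have h : Complex.exp (Complex.I * φ₂ (k₀ + b₁) + Complex.I * φ₁ k₀)
      = Complex.exp (Complex.I * φ₁ (k₀ + b₂) + Complex.I * φ₂ k₀) := by
    apply mul_right_cancel₀ h0
    rw [Complex.exp_add, Complex.exp_add, mul_assoc, mul_assoc, ← hA, ← hB, ← hB, ← hA,
      add_right_comm]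
  obtain ⟨n, hn⟩ := Complex.exp_eq_exp_iff_exists_int.mp h
  refine ⟨n, mul_left_cancel₀ Complex.I_ne_zero ?_⟩
  linear_combination hn
end

section
/- Let P : ℝ² → Matrix₂ₓ₂(ℂ) be a smooth family of 2×2 complex matrices such that for every k: P(k) is Hermitian, P(k)² = P(k), and tr P(k) = 1 (a rank-one projector), and P is ℤ²-periodic: P(k + m) = P(k) for all m ∈ ℤ². Define the Fubini–Study metric g^{ab}(k) = (1/2)·tr(∂ᵃP(k)·∂ᵇP(k)) for a,b ∈ {1,2} (a real symmetric 2×2 matrix). Then there exists k₀ ∈ ℝ² such that det g(k₀) = 0. -/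
open Matrix MeasureTheory

/-- The scalar triple product of three vectors of `ℝ³`. -/
def tripleProduct (u v w : Fin 3 → ℝ) : ℝ := u ⬝ᵥ crossProduct v w

theorem tripleProduct_apply (u v w : Fin 3 → ℝ) :
    tripleProduct u v w = u 0 * (v 1 * w 2 - v 2 * w 1) + u 1 * (v 2 * w 0 - v 0 * w 2)
      + u 2 * (v 0 * w 1 - v 1 * w 0) := by
  simp [tripleProduct, cross_apply, dotProduct, Fin.sum_univ_three]

theorem HasDerivAt.dotProduct_fin_three {u v : ℝ → Fin 3 → ℝ} {u' v' : Fin 3 → ℝ} {t : ℝ}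
    (hu : HasDerivAt u u' t) (hv : HasDerivAt v v' t) :
    HasDerivAt (fun s => u s ⬝ᵥ v s) (u' ⬝ᵥ v t + u t ⬝ᵥ v') t := by
  rw [hasDerivAt_pi] at hu hv
  simp only [dotProduct, Fin.sum_univ_three]
  exact ((((hu 0).mul (hv 0)).add ((hu 1).mul (hv 1))).add ((hu 2).mul (hv 2))).congr_deriv
    (by ring)

theorem HasDerivAt.tripleProduct {u v w : ℝ → Fin 3 → ℝ} {u' v' w' : Fin 3 → ℝ} {t : ℝ}
    (hu : HasDerivAt u u' t) (hv : HasDerivAt v v' t) (hw : HasDerivAt w w' t) :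
    HasDerivAt (fun s => tripleProduct (u s) (v s) (w s))
      (tripleProduct u' (v t) (w t) + tripleProduct (u t) v' (w t)
        + tripleProduct (u t) (v t) w') t := by
  rw [hasDerivAt_pi] at hu hv hw
  simp only [tripleProduct_apply]
  exact ((((hu 0).mul (((hv 1).mul (hw 2)).sub ((hv 2).mul (hw 1)))).add
    ((hu 1).mul (((hv 2).mul (hw 0)).sub ((hv 0).mul (hw 2))))).add
    ((hu 2).mul (((hv 0).mul (hw 1)).sub ((hv 1).mul (hw 0))))).congr_deriv (by
      simp only [Pi.mul_apply, Pi.sub_apply]; ring)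

theorem contDiff_dotProduct {u v : ℝ × ℝ → Fin 3 → ℝ} {m : WithTop ℕ∞}
    (hu : ContDiff ℝ m u) (hv : ContDiff ℝ m v) : ContDiff ℝ m (fun k => u k ⬝ᵥ v k) := by
  rw [contDiff_pi] at hu hv
  simp only [dotProduct]
  exact ContDiff.sum fun i _ => (hu i).mul (hv i)

theorem contDiff_tripleProduct {u v w : ℝ × ℝ → Fin 3 → ℝ} {m : WithTop ℕ∞}
    (hu : ContDiff ℝ m u) (hv : ContDiff ℝ m v) (hw : ContDiff ℝ m w) :
    ContDiff ℝ m (fun k => tripleProduct (u k) (v k) (w k)) := by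
  rw [contDiff_pi] at hu hv hw
  simp only [tripleProduct_apply]
  exact (((hu 0).mul (((hv 1).mul (hw 2)).sub ((hv 2).mul (hw 1)))).add
    ((hu 1).mul (((hv 2).mul (hw 0)).sub ((hv 0).mul (hw 2))))).add
    ((hu 2).mul (((hv 0).mul (hw 1)).sub ((hv 1).mul (hw 0))))

/-- A doubly periodic `C¹` vector field on the plane has nonpositive divergence somewhere. -/
theorem exists_divergence_nonpos_of_periodic {f g : ℝ × ℝ → ℝ}
    (hf : ContDiff ℝ 1 f) (hg : ContDiff ℝ 1 g)
    (hfp : ∀ y, f (1, y) = f (0, y)) (hgp : ∀ x, g (x, 1) = g (x, 0)) :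
    ∃ k, fderiv ℝ f k (1, 0) + fderiv ℝ g k (0, 1) ≤ 0 := by
  by_contra! hpos
  have hc : Continuous fun k => fderiv ℝ f k (1, 0) + fderiv ℝ g k (0, 1) :=
    ((hf.continuous_fderiv one_ne_zero).clm_apply continuous_const).add
      ((hg.continuous_fderiv one_ne_zero).clm_apply continuous_const)
  have key := integral2_divergence_prod_of_hasFDerivAt f g (fderiv ℝ f) (fderiv ℝ g) 0 0 1 1
    hf.continuous.continuousOn hg.continuous.continuousOn
    (fun x _ => (hf.differentiable one_ne_zero x).hasFDerivAt)
    (fun x _ => (hg.differentiable one_ne_zero x).hasFDerivAt)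
    (hc.continuousOn.integrableOn_compact (isCompact_uIcc.prod isCompact_uIcc))
  simp only [hfp, hgp] at key
  have hinner : Continuous fun x : ℝ => ∫ y in (0 : ℝ)..1,
      (fderiv ℝ f (x, y) (1, 0) + fderiv ℝ g (x, y) (0, 1)) :=
    intervalIntegral.continuous_parametric_intervalIntegral_of_continuous'
      (f := fun x y => fderiv ℝ f (x, y) (1, 0) + fderiv ℝ g (x, y) (0, 1)) hc 0 1
  have hlt := intervalIntegral.intervalIntegral_pos_of_pos (hinner.intervalIntegrable 0 1)
    (fun x => intervalIntegral.intervalIntegral_pos_of_pos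
      ((hc.comp (Continuous.prodMk_right x)).intervalIntegrable 0 1) (fun y => hpos (x, y))
      one_pos) one_pos
  rw [key] at hlt
  linarith

/-- A doubly periodic `C¹` vector field on the plane has vanishing divergence somewhere. -/
theorem exists_divergence_eq_zero_of_periodic {f g : ℝ × ℝ → ℝ}
    (hf : ContDiff ℝ 1 f) (hg : ContDiff ℝ 1 g)
    (hfp : ∀ y, f (1, y) = f (0, y)) (hgp : ∀ x, g (x, 1) = g (x, 0)) :
    ∃ k, fderiv ℝ f k (1, 0) + fderiv ℝ g k (0, 1) = 0 := by
  have hc : Continuous fun k => fderiv ℝ f k (1, 0) + fderiv ℝ g k (0, 1) :=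
    ((hf.continuous_fderiv one_ne_zero).clm_apply continuous_const).add
      ((hg.continuous_fderiv one_ne_zero).clm_apply continuous_const)
  refine mem_range_of_exists_le_of_exists_ge hc
    (exists_divergence_nonpos_of_periodic hf hg hfp hgp) ?_
  obtain ⟨k, hk⟩ := exists_divergence_nonpos_of_periodic hf.neg hg.neg
    (fun y => by simp [hfp]) (fun x => by simp [hgp])
  refine ⟨k, ?_⟩
  rw [fderiv_fun_neg, fderiv_fun_neg] at hk
  simp only [_root_.neg_apply] at hk
  linarith

/-- The pointwise curvature identity for the connection form of a tangent frame of the unit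
sphere whose first vector is `w`; here `a`, `b` are the two partial derivatives of `w`. -/
theorem sphere_curvature_identity {n w p a b : Fin 3 → ℝ} (hn : n ⬝ᵥ n = 1) (hw : n ⬝ᵥ w = 0)
    (hp : n ⬝ᵥ p = 0) (ha : n ⬝ᵥ a = -(w ⬝ᵥ w)) :
    (w ⬝ᵥ w) * (2 * tripleProduct n a b - tripleProduct p w a)
      - 2 * ((w ⬝ᵥ a) * tripleProduct n w b - (w ⬝ᵥ b) * tripleProduct n w a)
      = -((w ⬝ᵥ w) ^ 2 * tripleProduct n w p) := by
  have h₁ : (w ⬝ᵥ w) * tripleProduct n a b - (w ⬝ᵥ a) * tripleProduct n w b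
      + (w ⬝ᵥ b) * tripleProduct n w a = (n ⬝ᵥ w) * tripleProduct w a b := by
    simp only [tripleProduct_apply, dotProduct, Fin.sum_univ_three]; ring
  have h₂ : (n ⬝ᵥ n) * tripleProduct p w a = (n ⬝ᵥ p) * tripleProduct n w a
      + (n ⬝ᵥ w) * tripleProduct p n a - (n ⬝ᵥ a) * tripleProduct n w p := by
    simp only [tripleProduct_apply, dotProduct, Fin.sum_univ_three]; ring
  rw [hw] at h₁
  rw [hn, hp, hw, ha] at h₂
  linear_combination 2 * h₁ - (w ⬝ᵥ w) * h₂

theorem tripleProduct_sq {n w p : Fin 3 → ℝ} (hn : n ⬝ᵥ n = 1) (hw : n ⬝ᵥ w = 0)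
    (hp : n ⬝ᵥ p = 0) :
    tripleProduct n w p ^ 2 = (w ⬝ᵥ w) * (p ⬝ᵥ p) - (w ⬝ᵥ p) ^ 2 := by
  have h : tripleProduct n w p ^ 2 = (n ⬝ᵥ n) * ((w ⬝ᵥ w) * (p ⬝ᵥ p) - (w ⬝ᵥ p) ^ 2)
      - (n ⬝ᵥ w) * ((n ⬝ᵥ w) * (p ⬝ᵥ p) - (w ⬝ᵥ p) * (n ⬝ᵥ p))
      + (n ⬝ᵥ p) * ((n ⬝ᵥ w) * (w ⬝ᵥ p) - (w ⬝ᵥ w) * (n ⬝ᵥ p)) := by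
    simp only [tripleProduct_apply, dotProduct, Fin.sum_univ_three]; ring
  rw [h, hn, hw, hp]; ring

section Sphere

variable {n : ℝ × ℝ → Fin 3 → ℝ}

theorem ContDiff.fderiv_apply_const {f : ℝ × ℝ → Fin 3 → ℝ} (hf : ContDiff ℝ (⊤ : ℕ∞) f)
    (e : ℝ × ℝ) : ContDiff ℝ (⊤ : ℕ∞) (fun k => fderiv ℝ f k e) :=
  (hf.fderiv_right (m := (⊤ : ℕ∞)) le_rfl).clm_apply contDiff_const

theorem fderiv_apply_comm {f : ℝ × ℝ → Fin 3 → ℝ} (hf : ContDiff ℝ (⊤ : ℕ∞) f)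
    (e e' k : ℝ × ℝ) :
    fderiv ℝ (fun k => fderiv ℝ f k e) k e' = fderiv ℝ (fun k => fderiv ℝ f k e') k e := by
  have hd : DifferentiableAt ℝ (fderiv ℝ f) k :=
    (hf.fderiv_right (m := (⊤ : ℕ∞)) le_rfl).differentiable (by simp) k
  have hsymm : IsSymmSndFDerivAt ℝ f k :=
    hf.contDiffAt.isSymmSndFDerivAt (by
      rw [minSmoothness_of_isRCLikeNormedField]; exact WithTop.coe_le_coe.mpr le_top)
  have h : ∀ v v', fderiv ℝ (fun k => fderiv ℝ f k v) k v' = fderiv ℝ (fderiv ℝ f) k v' v := by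
    intro v v'
    rw [fderiv_clm_apply hd (differentiableAt_const v)]
    simp
  rw [h, h, hsymm.eq]

theorem fderiv_apply_periodic {f : ℝ × ℝ → Fin 3 → ℝ} {c : ℝ × ℝ} (hf : ∀ k, f (k + c) = f k)
    (e k : ℝ × ℝ) : fderiv ℝ f (k + c) e = fderiv ℝ f k e := by
  rw [← fderiv_comp_add_right]
  simp only [hf]

theorem hasDerivAt_line {f : ℝ × ℝ → Fin 3 → ℝ} (hf : ContDiff ℝ (⊤ : ℕ∞) f) (k e : ℝ × ℝ) :
    HasDerivAt (fun t : ℝ => f (k + t • e)) (fderiv ℝ f k e) 0 :=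
  (hf.differentiable (by simp) k).hasFDerivAt.hasLineDerivAt e

theorem dotProduct_fderiv_eq_zero (hn : ContDiff ℝ (⊤ : ℕ∞) n) (hunit : ∀ k, n k ⬝ᵥ n k = 1)
    (k e : ℝ × ℝ) : n k ⬝ᵥ fderiv ℝ n k e = 0 := by
  have h := (hasDerivAt_line hn k e).dotProduct_fin_three (hasDerivAt_line hn k e)
  simp only [hunit, zero_smul, add_zero] at h
  have h' := h.unique (hasDerivAt_const _ _)
  rw [dotProduct_comm] at h'
  linarith

theorem dotProduct_fderiv_fderiv (hn : ContDiff ℝ (⊤ : ℕ∞) n) (hunit : ∀ k, n k ⬝ᵥ n k = 1)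
    (k e e' : ℝ × ℝ) :
    n k ⬝ᵥ fderiv ℝ (fun k => fderiv ℝ n k e) k e' = -(fderiv ℝ n k e' ⬝ᵥ fderiv ℝ n k e) := by
  have h := (hasDerivAt_line hn k e').dotProduct_fin_three
    (hasDerivAt_line (hn.fderiv_apply_const e) k e')
  simp only [dotProduct_fderiv_eq_zero hn hunit, zero_smul, add_zero] at h
  have h' := h.unique (hasDerivAt_const _ _)
  linarith

/-- The connection form, evaluated on `e`, of the tangent frame along `n` whose first vector is
the derivative of `n` in the first direction. -/
noncomputable def connectionForm (n : ℝ × ℝ → Fin 3 → ℝ) (e k : ℝ × ℝ) : ℝ :=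
  tripleProduct (n k) (fderiv ℝ n k (1, 0)) (fderiv ℝ (fun k => fderiv ℝ n k (1, 0)) k e) /
    (fderiv ℝ n k (1, 0) ⬝ᵥ fderiv ℝ n k (1, 0))

theorem contDiff_connectionForm (hn : ContDiff ℝ (⊤ : ℕ∞) n)
    (hne : ∀ k, fderiv ℝ n k (1, 0) ⬝ᵥ fderiv ℝ n k (1, 0) ≠ 0) (e : ℝ × ℝ) :
    ContDiff ℝ (⊤ : ℕ∞) (connectionForm n e) :=
  (contDiff_tripleProduct hn (hn.fderiv_apply_const _)
    ((hn.fderiv_apply_const _).fderiv_apply_const e)).div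
    (contDiff_dotProduct (hn.fderiv_apply_const _) (hn.fderiv_apply_const _)) hne

theorem connectionForm_periodic {c : ℝ × ℝ} (hper : ∀ k, n (k + c) = n k) (e k : ℝ × ℝ) :
    connectionForm n e (k + c) = connectionForm n e k := by
  simp only [connectionForm, hper, fderiv_apply_periodic hper,
    fderiv_apply_periodic (f := fun k => fderiv ℝ n k (1, 0))
      (fderiv_apply_periodic hper (1, 0))]

theorem fderiv_connectionForm (hn : ContDiff ℝ (⊤ : ℕ∞) n)
    (hne : ∀ k, fderiv ℝ n k (1, 0) ⬝ᵥ fderiv ℝ n k (1, 0) ≠ 0) (e e' k : ℝ × ℝ) :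
    fderiv ℝ (connectionForm n e) k e' =
      let w := fun k => fderiv ℝ n k (1, 0)
      ((tripleProduct (fderiv ℝ n k e') (w k) (fderiv ℝ w k e)
        + tripleProduct (n k) (fderiv ℝ w k e') (fderiv ℝ w k e)
        + tripleProduct (n k) (w k) (fderiv ℝ (fun k => fderiv ℝ w k e) k e')) * (w k ⬝ᵥ w k)
        - tripleProduct (n k) (w k) (fderiv ℝ w k e) * (2 * (w k ⬝ᵥ fderiv ℝ w k e')))
        / (w k ⬝ᵥ w k) ^ 2 := by
  extract_lets w
  have hw : ContDiff ℝ (⊤ : ℕ∞) w := hn.fderiv_apply_const _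
  have h₁ := hasDerivAt_line hn k e'
  have h₂ := hasDerivAt_line hw k e'
  have h₃ := hasDerivAt_line (hw.fderiv_apply_const e) k e'
  have h := (h₁.tripleProduct h₂ h₃).fun_div (h₂.dotProduct_fin_three h₂)
    (by simpa using hne k)
  have h' : HasDerivAt (fun t : ℝ => connectionForm n e (k + t • e'))
      (fderiv ℝ (connectionForm n e) k e') 0 :=
    ((contDiff_connectionForm hn hne e).differentiable (by simp) k).hasFDerivAt.hasLineDerivAt e'
  rw [h'.unique h]
  simp only [zero_smul, add_zero]
  rw [dotProduct_comm (fderiv ℝ w k e') (w k), two_mul]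

/-- A doubly periodic smooth map from the plane to the unit sphere of `ℝ³` has a critical point. -/
theorem exists_tripleProduct_eq_zero (hn : ContDiff ℝ (⊤ : ℕ∞) n)
    (hunit : ∀ k, n k ⬝ᵥ n k = 1) (hper₁ : ∀ k, n (k + (1, 0)) = n k)
    (hper₂ : ∀ k, n (k + (0, 1)) = n k) :
    ∃ k, tripleProduct (n k) (fderiv ℝ n k (1, 0)) (fderiv ℝ n k (0, 1)) = 0 := by
  by_contra! hJ
  have hne : ∀ k, fderiv ℝ n k (1, 0) ⬝ᵥ fderiv ℝ n k (1, 0) ≠ 0 := by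
    intro k hk
    rw [dotProduct_self_eq_zero] at hk
    exact hJ k (by rw [hk]; simp [tripleProduct_apply])
  have hsm := fun e => (contDiff_connectionForm hn hne e).of_le (m := 1)
    (by exact_mod_cast le_top)
  obtain ⟨k, hk⟩ := exists_divergence_eq_zero_of_periodic (hsm (0, 1)) (hsm (1, 0)).neg
    (fun y => by simpa using connectionForm_periodic hper₁ (0, 1) (0, y))
    (fun x => by simpa using connectionForm_periodic hper₂ (1, 0) (x, 0))
  rw [fderiv_fun_neg, _root_.neg_apply, fderiv_connectionForm hn hne,
    fderiv_connectionForm hn hne] at hk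
  simp only at hk
  have hcurv := sphere_curvature_identity
    (b := fderiv ℝ (fun k => fderiv ℝ n k (1, 0)) k (0, 1)) (hunit k)
    (dotProduct_fderiv_eq_zero hn hunit k (1, 0)) (dotProduct_fderiv_eq_zero hn hunit k (0, 1))
    (dotProduct_fderiv_fderiv hn hunit k (1, 0) (1, 0))
  rw [fderiv_apply_comm (hn.fderiv_apply_const (1, 0)) (0, 1) (1, 0) k] at hk
  specialize hne k
  specialize hJ k
  revert hk hcurv hne hJ
  generalize fderiv ℝ (fun k => fderiv ℝ (fun k => fderiv ℝ n k (1, 0)) k (1, 0)) k (0, 1) = c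
  generalize fderiv ℝ (fun k => fderiv ℝ n k (1, 0)) k (1, 0) = a
  generalize fderiv ℝ (fun k => fderiv ℝ n k (1, 0)) k (0, 1) = b
  generalize fderiv ℝ n k (1, 0) = w
  generalize fderiv ℝ n k (0, 1) = p
  generalize n k = u
  intro hJ hne hk hcurv
  have h₀ : tripleProduct w w b = 0 := by simp only [tripleProduct_apply]; ring
  have h₁ : tripleProduct u b a = -tripleProduct u a b := by
    simp only [tripleProduct_apply]; ring
  rw [h₀, h₁] at hk
  field_simp at hk
  have : (w ⬝ᵥ w) ^ 2 * tripleProduct u w p = 0 := by linear_combination hcurv - hk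
  exact hJ ((mul_eq_zero.mp this).resolve_left (pow_ne_zero 2 hne))

end Sphere

/-- The Bloch vector of a Hermitian `2 × 2` matrix of trace one. -/
def blochVector (A : Matrix (Fin 2) (Fin 2) ℂ) : Fin 3 → ℝ :=
  ![2 * (A 0 1).re, 2 * (A 0 1).im, 2 * (A 0 0).re - 1]

theorem eq_of_blochVector {A : Matrix (Fin 2) (Fin 2) ℂ} (hA : A.IsHermitian)
    (htr : A.trace = 1) :
    A = !![(1 + (blochVector A 2 : ℂ)) / 2, (blochVector A 0 + blochVector A 1 * Complex.I) / 2;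
      (blochVector A 0 - blochVector A 1 * Complex.I) / 2, (1 - (blochVector A 2 : ℂ)) / 2] := by
  have h₀ := hA.apply 0 0
  have h₁ := hA.apply 1 0
  rw [Matrix.trace_fin_two] at htr
  have h₂ : A 1 1 = 1 - A 0 0 := by linear_combination htr
  have h₃ : (A 0 0).im = 0 := Complex.conj_eq_iff_im.mp h₀
  ext i j
  fin_cases i <;> fin_cases j <;> apply Complex.ext <;>
    simp [blochVector, h₂, h₃, ← h₁] <;> ring

theorem blochVector_dotProduct_self {A : Matrix (Fin 2) (Fin 2) ℂ} (hA : A.IsHermitian)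
    (hproj : A * A = A) : blochVector A ⬝ᵥ blochVector A = 1 := by
  have h₁ := hA.apply 1 0
  have h₃ : (A 0 0).im = 0 := Complex.conj_eq_iff_im.mp (hA.apply 0 0)
  have h := congrArg Complex.re (congrFun (congrFun hproj 0) 0)
  simp [Matrix.mul_apply, Fin.sum_univ_two, ← h₁, h₃] at h
  simp [blochVector, dotProduct, Fin.sum_univ_three]
  linear_combination 4 * h

theorem hasDerivAt_of_blochVector {A : ℝ → Matrix (Fin 2) (Fin 2) ℂ} {v : Fin 3 → ℝ} {t : ℝ}
    (hA : ∀ s, (A s).IsHermitian) (htr : ∀ s, (A s).trace = 1)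
    (h : HasDerivAt (fun s => blochVector (A s)) v t) (i j : Fin 2) :
    HasDerivAt (fun s => A s i j)
      (!![(v 2 : ℂ) / 2, (v 0 + v 1 * Complex.I) / 2;
        (v 0 - v 1 * Complex.I) / 2, -(v 2 : ℂ) / 2] i j) t := by
  rw [hasDerivAt_pi] at h
  have hc : ∀ l, HasDerivAt (fun s => (blochVector (A s) l : ℂ)) (v l : ℂ) t :=
    fun l => (h l).ofReal_comp
  have hfun : (fun s => A s i j) = fun s =>
      !![(1 + (blochVector (A s) 2 : ℂ)) / 2,
        (blochVector (A s) 0 + blochVector (A s) 1 * Complex.I) / 2;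
        (blochVector (A s) 0 - blochVector (A s) 1 * Complex.I) / 2,
        (1 - (blochVector (A s) 2 : ℂ)) / 2] i j :=
    funext fun s => congrFun (congrFun (eq_of_blochVector (hA s) (htr s)) i) j
  rw [hfun]
  fin_cases i <;> fin_cases j
  · exact ((hc 2).const_add 1).div_const 2
  · exact ((hc 0).add ((hc 1).mul_const Complex.I)).div_const 2
  · exact ((hc 0).sub ((hc 1).mul_const Complex.I)).div_const 2
  · exact ((hc 2).const_sub 1).div_const 2

theorem half_trace_mul_re (v w : Fin 3 → ℝ) :
    (((1 : ℂ) / 2) * (!![(v 2 : ℂ) / 2, (v 0 + v 1 * Complex.I) / 2;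
        (v 0 - v 1 * Complex.I) / 2, -(v 2 : ℂ) / 2] *
      !![(w 2 : ℂ) / 2, (w 0 + w 1 * Complex.I) / 2;
        (w 0 - w 1 * Complex.I) / 2, -(w 2 : ℂ) / 2]).trace).re = (v ⬝ᵥ w) / 4 := by
  have h : ((1 : ℂ) / 2) * (!![(v 2 : ℂ) / 2, (v 0 + v 1 * Complex.I) / 2;
        (v 0 - v 1 * Complex.I) / 2, -(v 2 : ℂ) / 2] *
      !![(w 2 : ℂ) / 2, (w 0 + w 1 * Complex.I) / 2;
        (w 0 - w 1 * Complex.I) / 2, -(w 2 : ℂ) / 2]).trace = ((v ⬝ᵥ w / 4 : ℝ) : ℂ) := by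
    simp [Matrix.trace_fin_two, dotProduct, Fin.sum_univ_three]
    linear_combination (-(v 1 * w 1 : ℂ) / 4) * Complex.I_sq
  rw [h, Complex.ofReal_re]

/-- For a smooth ℤ²-periodic family of rank-one Hermitian projectors
`P : ℝ² → M₂(ℂ)` (a two-band model over the Brillouin-zone torus), the Fubini–Study
metric `g^{ab} = (1/2)·Re tr(∂ᵃP ∂ᵇP)` must have vanishing determinant somewhere. -/
theorem stmt16 (P : ℝ × ℝ → Matrix (Fin 2) (Fin 2) ℂ)
    (hsmooth : ∀ i j : Fin 2, ContDiff ℝ (⊤ : ℕ∞) (fun k => P k i j))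
    (hherm : ∀ k, (P k).IsHermitian)
    (hproj : ∀ k, P k * P k = P k)
    (htr : ∀ k, (P k).trace = 1)
    (hper : ∀ (k : ℝ × ℝ) (m n : ℤ), P (k.1 + (m : ℝ), k.2 + (n : ℝ)) = P k)
    (dP : Fin 2 → ℝ × ℝ → Matrix (Fin 2) (Fin 2) ℂ)
    (hdP0 : ∀ (k : ℝ × ℝ) (i j : Fin 2),
      dP 0 k i j = deriv (fun s => P (s, k.2) i j) k.1)
    (hdP1 : ∀ (k : ℝ × ℝ) (i j : Fin 2),
      dP 1 k i j = deriv (fun s => P (k.1, s) i j) k.2)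
    (g : Fin 2 → Fin 2 → ℝ × ℝ → ℝ)
    (hgdef : ∀ (a b : Fin 2) (k : ℝ × ℝ),
      g a b k = (((1 : ℂ) / 2) * (dP a k * dP b k).trace).re) :
    ∃ k₀ : ℝ × ℝ, g 0 0 k₀ * g 1 1 k₀ - g 0 1 k₀ * g 1 0 k₀ = 0 := by
  set n : ℝ × ℝ → Fin 3 → ℝ := fun k => blochVector (P k)
  have hn : ContDiff ℝ (⊤ : ℕ∞) n := by
    have hre : ∀ i j, ContDiff ℝ (⊤ : ℕ∞) fun k => (P k i j).re :=
      fun i j => Complex.reCLM.contDiff.comp (hsmooth i j)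
    have him : ∀ i j, ContDiff ℝ (⊤ : ℕ∞) fun k => (P k i j).im :=
      fun i j => Complex.imCLM.contDiff.comp (hsmooth i j)
    rw [contDiff_pi]
    intro i
    fin_cases i
    · exact contDiff_const.mul (hre 0 1)
    · exact contDiff_const.mul (him 0 1)
    · exact (contDiff_const.mul (hre 0 0)).sub contDiff_const
  have hunit : ∀ k, n k ⬝ᵥ n k = 1 := fun k => blochVector_dotProduct_self (hherm k) (hproj k)
  have hper₁ : ∀ k, n (k + (1, 0)) = n k := fun k =>
    congrArg blochVector (by simpa [Prod.add_def] using hper k 1 0)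
  have hper₂ : ∀ k, n (k + (0, 1)) = n k := fun k =>
    congrArg blochVector (by simpa [Prod.add_def] using hper k 0 1)
  obtain ⟨k, hk⟩ := exists_tripleProduct_eq_zero hn hunit hper₁ hper₂
  have hgram := tripleProduct_sq (hunit k) (dotProduct_fderiv_eq_zero hn hunit k (1, 0))
    (dotProduct_fderiv_eq_zero hn hunit k (0, 1))
  rw [hk] at hgram
  have hfd := (hn.differentiable (by simp) k).hasFDerivAt
  have h₁ : HasDerivAt (fun s => n (s, k.2)) (fderiv ℝ n k (1, 0)) k.1 :=
    hfd.comp_hasDerivAt (f := fun s => (s, k.2)) k.1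
      ((hasDerivAt_id k.1).prodMk (hasDerivAt_const k.1 k.2))
  have h₂ : HasDerivAt (fun s => n (k.1, s)) (fderiv ℝ n k (0, 1)) k.2 :=
    hfd.comp_hasDerivAt (f := fun s => (k.1, s)) k.2
      ((hasDerivAt_const k.2 k.1).prodMk (hasDerivAt_id k.2))
  have hd₁ := Matrix.ext fun i j => (hdP0 k i j).trans
    (hasDerivAt_of_blochVector (fun s => hherm (s, k.2)) (fun s => htr (s, k.2)) h₁ i j).deriv
  have hd₂ := Matrix.ext fun i j => (hdP1 k i j).trans
    (hasDerivAt_of_blochVector (fun s => hherm (k.1, s)) (fun s => htr (k.1, s)) h₂ i j).deriv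
  refine ⟨k, ?_⟩
  simp only [hgdef, hd₁, hd₂, half_trace_mul_re]
  rw [dotProduct_comm (fderiv ℝ n k (0, 1)) (fderiv ℝ n k (1, 0))]
  linear_combination -hgram / 16
end

section
/- Let b₁, b₂ ∈ ℂ with b₂/b₁ ∉ ℝ, and let Λ = {m·b₁ + n·b₂ : m, n ∈ ℤ}. Let f, g : ℂ → ℂ be entire functions and μ₁, μ₂ : ℂ → ℂ functions such that f(k + bⱼ) = μⱼ(k)·f(k) and g(k + bⱼ) = μⱼ(k)·g(k) for all k ∈ ℂ and j = 1,2 (f and g satisfy the same quasi-periodic boundary conditions). Suppose there is z₀ ∈ ℂ such that the zero set of g is exactly z₀ + Λ and every zero of g is simple (g'(z) ≠ 0 whenever g(z) = 0). Then there exists a constant c ∈ ℂ with f(k) = c·g(k) for all k ∈ ℂ. -/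
open Filter Topology

namespace PeriodPair

variable (L : PeriodPair)

lemma lattice_periodic {E : ℂ → ℂ} (h₁ : Function.Periodic E L.ω₁)
    (h₂ : Function.Periodic E L.ω₂) {l : ℂ} (hl : l ∈ L.lattice) : Function.Periodic E l := by
  obtain ⟨m, n, rfl⟩ := mem_lattice.mp hl
  exact (h₁.int_mul m).add_period (h₂.int_mul n)

/-- A doubly periodic function, holomorphic off the lattice and with a removable singularity
at the origin, is constant off the lattice. -/
lemma exists_eq_const_of_eventuallyEq {E q : ℂ → ℂ} (h₁ : Function.Periodic E L.ω₁)
    (h₂ : Function.Periodic E L.ω₂) (hd : ∀ z ∉ L.lattice, DifferentiableAt ℂ E z)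
    (hq : DifferentiableAt ℂ q 0) (hE : E =ᶠ[𝓝[≠] 0] q) :
    ∃ c, ∀ z ∉ L.lattice, E z = c := by
  classical
  let F : ℂ → ℂ := fun z ↦ if z ∈ L.lattice then q 0 else E z
  have hFper {l : ℂ} (hl : l ∈ L.lattice) : Function.Periodic F l := fun z ↦ by
    simp only [F, add_mem_cancel_right hl, L.lattice_periodic h₁ h₂ hl z]
  have hF0 : F =ᶠ[𝓝 0] q := by
    filter_upwards [L.compl_lattice_sdiff_singleton_mem_nhds 0,
      eventually_nhdsWithin_iff.mp hE] with z hz hz'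
    by_cases h : z = 0
    · simp [F, h]
    · have : z ∉ L.lattice := by simp_all
      simp only [F, if_neg this]
      exact hz' h
  have hF : Differentiable ℂ F := fun z ↦ by
    by_cases hz : z ∈ L.lattice
    · have h : F = fun w ↦ F (w - z) := funext fun w ↦ ((hFper hz).sub_eq w).symm
      rw [h]
      have h0 : DifferentiableAt ℂ F (z - z) := by
        rw [sub_self]
        exact hq.congr_of_eventuallyEq hF0
      exact DifferentiableAt.comp (f := fun w ↦ w - z) z h0 (differentiableAt_id.sub_const z)
    · refine (hd z hz).congr_of_eventuallyEq ?_
      filter_upwards [L.isClosed_lattice.isOpen_compl.mem_nhds hz] with w hw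
      exact if_neg hw
  obtain ⟨c, hc⟩ := hF.exists_const_forall_eq_of_bounded
    (IsZLattice.isCompact_range_of_periodic L.lattice F hF.continuous
      fun z w hw ↦ hFper hw z).isBounded
  exact ⟨c, fun z hz ↦ by rw [← hc z]; exact (if_neg hz).symm⟩

/-- The period pair obtained by halving the first period. -/
noncomputable def halfFirst : PeriodPair where
  ω₁ := L.ω₁ / 2
  ω₂ := L.ω₂
  indep := by
    refine LinearIndependent.pair_iff.mpr fun s t h ↦ ?_
    have := LinearIndependent.pair_iff.mp L.indep (s / 2) t (by
      rw [← h]; simp only [Complex.real_smul]; push_cast; ring)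
    simpa using this

lemma lattice_le_halfFirst : L.lattice ≤ L.halfFirst.lattice := by
  refine Submodule.span_le.mpr ?_
  rintro x (rfl | rfl)
  · simpa [halfFirst] using
      add_mem L.halfFirst.ω₁_mem_lattice L.halfFirst.ω₁_mem_lattice
  · exact L.halfFirst.ω₂_mem_lattice

end PeriodPair

lemma AnalyticAt.dslope_self {f : ℂ → ℂ} {z : ℂ} (hf : AnalyticAt ℂ f z) :
    AnalyticAt ℂ (dslope f z) z :=
  let ⟨_, hp⟩ := hf
  hp.has_fpower_series_dslope_fslope.analyticAt

/-- A quotient with at most a simple pole at the origin is `p z / z` with `p` analytic. -/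
lemma exists_analyticAt_div_eq_div_self {f g : ℂ → ℂ} (hf : AnalyticAt ℂ f 0)
    (hg : AnalyticAt ℂ g 0) (hg0 : g 0 = 0) (hg' : deriv g 0 ≠ 0) :
    ∃ p : ℂ → ℂ, AnalyticAt ℂ p 0 ∧ ∀ z, f z / g z = p z / z := by
  refine ⟨fun z ↦ f z / dslope g 0 z, hf.div hg.dslope_self (by simpa using hg'), fun z ↦ ?_⟩
  have h := sub_smul_dslope g 0 z
  simp only [sub_zero, smul_eq_mul, hg0] at h
  rw [← h, div_div, mul_comm]

/-- Quotients of functions with the same multiplier are periodic. -/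
lemma Function.Periodic.div_of_multiplier {f g μ : ℂ → ℂ} {b : ℂ}
    (hf : ∀ k, f (k + b) = μ k * f k) (hg : ∀ k, g (k + b) = μ k * g k)
    (hz : ∀ k, g (k + b) = 0 → g k = 0) : Function.Periodic (fun z ↦ f z / g z) b := fun k ↦ by
  by_cases hk : g (k + b) = 0
  · simp [hk, hz k hk]
  · have hμ : μ k ≠ 0 := fun h ↦ hk (by rw [hg, h, zero_mul])
    simp only [hf, hg, mul_div_mul_left _ _ hμ]

/-- An odd doubly periodic quotient of entire functions with at most simple poles, all of them
at lattice points, vanishes. -/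
lemma PeriodPair.eq_zero_of_odd_div (L : PeriodPair) {f g : ℂ → ℂ} (hf : Differentiable ℂ f)
    (hg : Differentiable ℂ g) (h₁ : Function.Periodic (fun z ↦ f z / g z) L.ω₁)
    (h₂ : Function.Periodic (fun z ↦ f z / g z) L.ω₂) (hzeros : ∀ z, g z = 0 ↔ z ∈ L.lattice)
    (hg' : deriv g 0 ≠ 0) (hodd : (fun z ↦ f z / g z).Odd) : f = 0 := by
  set h : ℂ → ℂ := fun z ↦ f z / g z with hh
  have hd {z : ℂ} (hz : z ∉ L.lattice) : DifferentiableAt ℂ h z :=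
    (hf z).div (hg z) ((hzeros z).not.mpr hz)
  have half_zero {w : ℂ} (hw : Function.Periodic h w) : h (w / 2) = 0 := by
    have := hw (-(w / 2))
    rw [show -(w / 2) + w = w / 2 by ring, hodd] at this
    linear_combination this / 2
  -- the zero of `h` at the half period cancels the pole of the other factor
  let P : ℂ → ℂ := fun z ↦ h z * h (z + L.ω₁ / 2)
  obtain ⟨p, hp, hpe⟩ := exists_analyticAt_div_eq_div_self (hf.analyticAt 0) (hg.analyticAt 0)
    ((hzeros 0).mpr (zero_mem _)) hg'
  have hs : AnalyticAt ℂ (fun z ↦ h (z + L.ω₁ / 2)) 0 := by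
    have hne : g (0 + L.ω₁ / 2) ≠ 0 := by
      rw [zero_add]; exact (hzeros _).not.mpr L.ω₁_div_two_notMem_lattice
    exact ((hf.comp (differentiable_id.add_const _)).analyticAt 0).div
      ((hg.comp (differentiable_id.add_const _)).analyticAt 0) hne
  have hmem : L.ω₁ / 2 ∈ L.halfFirst.lattice := L.halfFirst.ω₁_mem_lattice
  obtain ⟨c, hc⟩ := L.halfFirst.exists_eq_const_of_eventuallyEq (E := P)
    (q := fun z ↦ p z * dslope (fun z ↦ h (z + L.ω₁ / 2)) 0 z)
    (fun z ↦ by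
      have := h₁ z
      simp only [P, PeriodPair.halfFirst]
      rw [show z + L.ω₁ / 2 + L.ω₁ / 2 = z + L.ω₁ by ring, this, mul_comm])
    (fun z ↦ by
      simp only [P, PeriodPair.halfFirst]
      rw [add_right_comm, h₂, h₂])
    (fun z hz ↦ by
      refine (hd fun h ↦ hz (L.lattice_le_halfFirst h)).mul ?_
      refine DifferentiableAt.comp z (hd fun h ↦ hz ?_) (differentiableAt_id.add_const _)
      exact (add_mem_cancel_right hmem).mp (L.lattice_le_halfFirst h))
    (hp.mul hs.dslope_self).differentiableAt
    (by
      filter_upwards [self_mem_nhdsWithin] with z hz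
      have hz0 : z ≠ 0 := hz
      have e := sub_smul_dslope (fun z ↦ h (z + L.ω₁ / 2)) 0 z
      simp only [sub_zero, smul_eq_mul, zero_add, half_zero h₁] at e
      simp only [P]
      rw [← e, show h z = p z / z from hpe z, ← mul_assoc, div_mul_cancel₀ _ hz0])
  have hc0 : c = 0 := by
    rw [← hc (L.ω₂ / 2) L.halfFirst.ω₂_div_two_notMem_lattice]
    simp only [P, half_zero h₂, zero_mul]
  have hprod : ∀ᶠ z in 𝓝 (L.ω₂ / 2), f z * f (z + L.ω₁ / 2) = 0 := by
    filter_upwards [L.halfFirst.isClosed_lattice.isOpen_compl.mem_nhds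
      L.halfFirst.ω₂_div_two_notMem_lattice] with z hz
    have hz' : z ∉ L.lattice := fun h ↦ hz (L.lattice_le_halfFirst h)
    have hz'' : z + L.ω₁ / 2 ∉ L.lattice := fun h ↦
      hz ((add_mem_cancel_right hmem).mp (L.lattice_le_halfFirst h))
    have := hc z hz
    simpa [P, hh, hc0, (hzeros _).not.mpr hz', (hzeros _).not.mpr hz''] using this
  have hfa : AnalyticOnNhd ℂ f Set.univ := fun z _ ↦ hf.analyticAt z
  have hfs : Differentiable ℂ fun z ↦ f (z + L.ω₁ / 2) :=
    hf.comp (differentiable_id.add_const _)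
  by_contra hne
  have hcod {F : ℂ → ℂ} (hF : Differentiable ℂ F) (hF0 : ∃ᶠ z in 𝓝[≠] (L.ω₂ / 2), F z = 0) :
      F = 0 :=
    AnalyticOnNhd.eq_of_frequently_eq (fun z _ ↦ hF.analyticAt z)
      (fun z _ ↦ analyticAt_const) hF0
  have hor : ∃ᶠ z in 𝓝[≠] (L.ω₂ / 2), f z = 0 ∨ f (z + L.ω₁ / 2) = 0 :=
    ((eventually_nhdsWithin_of_eventually_nhds hprod).mono fun z hz ↦
      mul_eq_zero.mp hz).frequently
  rcases frequently_or_distrib.mp hor with h | h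
  · exact hne (hcod hf h)
  · refine hne (funext fun z ↦ ?_)
    simpa using congrFun (hcod hfs h) (z - L.ω₁ / 2)

/-- Entire functions with doubly periodic quotient are proportional if the denominator has exactly
the lattice points as zeros, and the zero at the origin is simple. -/
lemma PeriodPair.exists_eq_const_mul (L : PeriodPair) {f g : ℂ → ℂ} (hf : Differentiable ℂ f)
    (hg : Differentiable ℂ g) (h₁ : Function.Periodic (fun z ↦ f z / g z) L.ω₁)
    (h₂ : Function.Periodic (fun z ↦ f z / g z) L.ω₂) (hzeros : ∀ z, g z = 0 ↔ z ∈ L.lattice)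
    (hg' : deriv g 0 ≠ 0) : ∃ c, ∀ z, f z = c * g z := by
  set h : ℂ → ℂ := fun z ↦ f z / g z with hh
  have hd {z : ℂ} (hz : z ∉ L.lattice) : DifferentiableAt ℂ h z :=
    (hf z).div (hg z) ((hzeros z).not.mpr hz)
  obtain ⟨p, hp, hpe⟩ := exists_analyticAt_div_eq_div_self (hf.analyticAt 0) (hg.analyticAt 0)
    ((hzeros 0).mpr (zero_mem _)) hg'
  have hneg {w : ℂ} (hw : Function.Periodic h w) :
      Function.Periodic (fun z ↦ h z + h (-z)) w := fun z ↦ by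
    simp only [neg_add, ← sub_eq_add_neg, hw z, hw.sub_eq]
  obtain ⟨c, hc⟩ := L.exists_eq_const_of_eventuallyEq (E := fun z ↦ h z + h (-z))
    (q := fun z ↦ dslope p 0 z + dslope p 0 (-z)) (hneg h₁) (hneg h₂)
    (fun z hz ↦ (hd hz).add
      (DifferentiableAt.comp z (hd (by simpa using hz)) differentiableAt_id.neg))
    (by
      have h0 := hp.dslope_self.differentiableAt
      refine h0.add (DifferentiableAt.comp (g := dslope p 0) 0 ?_ differentiableAt_id.neg)
      simpa using h0)
    (by
      filter_upwards [self_mem_nhdsWithin] with z hz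
      have hz0 : z ≠ 0 := hz
      have e₁ := sub_smul_dslope p 0 z
      have e₂ := sub_smul_dslope p 0 (-z)
      simp only [sub_zero, smul_eq_mul] at e₁ e₂
      rw [show h z = p z / z from hpe z, show h (-z) = p (-z) / -z from hpe (-z)]
      field_simp
      linear_combination e₂ - e₁)
  have hdiv (z : ℂ) (hz : z ∉ L.lattice) : (f z - c / 2 * g z) / g z = h z - c / 2 := by
    have := (hzeros z).not.mpr hz
    simp only [hh]
    field_simp
  have hdiv0 (z : ℂ) (hz : z ∈ L.lattice) : (f z - c / 2 * g z) / g z = 0 := by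
    rw [(hzeros z).mpr hz, div_zero]
  have hper {w : ℂ} (hw : Function.Periodic h w) (hwL : w ∈ L.lattice) :
      Function.Periodic (fun z ↦ (f z - c / 2 * g z) / g z) w := fun z ↦ by
    by_cases hz : z ∈ L.lattice
    · simp only [hdiv0 z hz, hdiv0 _ (add_mem hz hwL)]
    · simp only [hdiv z hz, hdiv (z + w) (by rwa [add_mem_cancel_right hwL]), hw z]
  have hzero := L.eq_zero_of_odd_div (f := fun z ↦ f z - c / 2 * g z)
    (hf.sub (hg.const_mul _)) hg (hper h₁ L.ω₁_mem_lattice) (hper h₂ L.ω₂_mem_lattice) hzeros hg'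
    (fun z ↦ by
      by_cases hz : z ∈ L.lattice
      · simp only [hdiv0 z hz, hdiv0 (-z) (neg_mem hz), neg_zero]
      · simp only [hdiv z hz, hdiv (-z) (by simpa using hz)]
        linear_combination hc z hz)
  exact ⟨c / 2, fun z ↦ sub_eq_zero.mp (congrFun hzero z)⟩

/-- Two entire functions satisfying the same quasi-periodic boundary
conditions (same multipliers `μⱼ` for translations by `b₁, b₂` spanning a lattice `Λ`),
one of which has zero set exactly `z₀ + Λ` with all zeros simple, are proportional. -/
theorem stmt17 (b₁ b₂ : ℂ) (hτ : b₂ / b₁ ∉ Set.range ((↑) : ℝ → ℂ))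
    (f g : ℂ → ℂ) (hf : Differentiable ℂ f) (hg : Differentiable ℂ g)
    (μ₁ μ₂ : ℂ → ℂ)
    (hf₁ : ∀ k, f (k + b₁) = μ₁ k * f k) (hf₂ : ∀ k, f (k + b₂) = μ₂ k * f k)
    (hg₁ : ∀ k, g (k + b₁) = μ₁ k * g k) (hg₂ : ∀ k, g (k + b₂) = μ₂ k * g k)
    (z₀ : ℂ)
    (hzeros : ∀ z, g z = 0 ↔ ∃ m n : ℤ, z = z₀ + (m : ℂ) * b₁ + (n : ℂ) * b₂)
    (hsimple : ∀ z, g z = 0 → deriv g z ≠ 0) :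
    ∃ c : ℂ, ∀ k, f k = c * g k := by
  have hb₁ : b₁ ≠ 0 := by
    rintro rfl
    exact hτ ⟨0, by simp⟩
  let L : PeriodPair := ⟨b₁, b₂, by
    refine LinearIndependent.pair_iff.mpr fun s t h ↦ ?_
    simp only [Complex.real_smul] at h
    have ht : t = 0 := by
      by_contra ht
      have ht' : (t : ℂ) ≠ 0 := by exact_mod_cast ht
      refine hτ ⟨-s / t, ?_⟩
      push_cast
      field_simp
      linear_combination -h
    subst ht
    simpa [hb₁] using h⟩
  have hgL (z : ℂ) : g (z + z₀) = 0 ↔ z ∈ L.lattice := by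
    rw [hzeros, PeriodPair.mem_lattice]
    refine exists₂_congr fun m n ↦ ⟨fun h ↦ ?_, fun h ↦ ?_⟩
    · linear_combination -h
    · linear_combination -h
  have hper {b : ℂ} {μ : ℂ → ℂ} (hb : b ∈ L.lattice) (hf : ∀ k, f (k + b) = μ k * f k)
      (hg : ∀ k, g (k + b) = μ k * g k) :
      Function.Periodic (fun z ↦ f (z + z₀) / g (z + z₀)) b :=
    Function.Periodic.div_of_multiplier (μ := fun z ↦ μ (z + z₀))
      (fun k ↦ by rw [add_right_comm, hf]) (fun k ↦ by rw [add_right_comm, hg])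
      (fun k ↦ by rw [hgL, hgL, add_mem_cancel_right hb]; exact id)
  obtain ⟨c, hc⟩ := L.exists_eq_const_mul (hf.comp (differentiable_id.add_const z₀))
    (hg.comp (differentiable_id.add_const z₀)) (hper L.ω₁_mem_lattice hf₁ hg₁)
    (hper L.ω₂_mem_lattice hf₂ hg₂) hgL (by
      change deriv (fun z ↦ g (z + z₀)) 0 ≠ 0
      rw [deriv_comp_add_const]
      exact hsimple _ ((hgL 0).mpr (zero_mem _)))
  exact ⟨c, fun k ↦ by simpa using hc (k - z₀)⟩
end
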